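/- Let p ∈ (1,∞] and let q ∈ [1,∞) satisfy 1/p + 1/q = 1 (with q = 1 when p = ∞). Let φ : {0,1,…,d} → [0,+∞] satisfy φ(0) = 0, φ(l) > 0 for all l ∈ {1,…,d}, φ(l₀) < +∞ for at least one l₀ ∈ {1,…,d}, and suppose l ↦ φ(l)^q / l is nondecreasing on {1,…,d}. Then φ(1) < +∞ and the norm φ(1)·‖·‖₁ is the tightest norm below φ∘ℓ0 on the unit ball B_p of the ℓp-norm: (i) for every x with ‖x‖_p ≤ 1, φ(1)·‖x‖₁ ≤ φ(ℓ0(x)) (as elements of [0,+∞]); and (ii) every norm N on ℝ^d with N(x) ≤ φ(ℓ0(x)) for all x ∈ B_p satisfies N(x) ≤ φ(1)·‖x‖₁ for all x ∈ ℝ^d. -/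

import Mathlib

open scoped Classical ENNReal

/-- The ℓ0 pseudonorm: number of nonzero components. -/
noncomputable def l0 {d : ℕ} (x : EuclideanSpace ℝ (Fin d)) : ℕ :=
  (Finset.univ.filter fun i => x i ≠ 0).card

/-- The ℓp-norm on ℝ^d, for `p ∈ [1,∞]` (`p = ⊤` gives the sup-norm). -/
noncomputable def lpNorm {d : ℕ} (p : ℝ≥0∞) (x : EuclideanSpace ℝ (Fin d)) : ℝ :=
  if p = ⊤ then ⨆ i, |x i| else (∑ i, |x i| ^ p.toReal) ^ (1 / p.toReal)

theorem mul_natCast_rpow_le_of_rpow_div_le {d : ℕ} {q : ℝ} (hq : 0 < q) {φ : ℕ → ℝ≥0∞}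
    (hφmono : ∀ l, 1 ≤ l → l + 1 ≤ d →
      φ l ^ q / (l : ℝ≥0∞) ≤ φ (l + 1) ^ q / ((l : ℝ≥0∞) + 1))
    {l : ℕ} (hl : l ≤ d) : φ 1 * (l : ℝ≥0∞) ^ (1 / q) ≤ φ l := by
  rcases Nat.eq_zero_or_pos l with rfl | hpos
  · simp [hq]
  have hdiv : φ 1 ^ q ≤ φ l ^ q / (l : ℝ≥0∞) := by
    induction l, hpos using Nat.le_induction with
    | base => simp
    | succ n hn ih =>
      push_cast
      exact (ih (by omega)).trans (hφmono n hn hl)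
  have hmul : φ 1 ^ q * (l : ℝ≥0∞) ≤ φ l ^ q :=
    (ENNReal.le_div_iff_mul_le (Or.inl (by simpa using hpos.ne'))
      (Or.inl (ENNReal.natCast_ne_top l))).1 hdiv
  rw [← ENNReal.rpow_le_rpow_iff hq, ENNReal.mul_rpow_of_nonneg _ _ hq.le, ← ENNReal.rpow_mul,
    one_div_mul_cancel hq.ne', ENNReal.rpow_one]
  exact hmul

theorem sum_abs_le_l0_rpow {d : ℕ} {p : ℝ≥0∞} (hp : 1 < p) {q : ℝ}
    (hpq : if p = ⊤ then q = 1 else 1 / p.toReal + 1 / q = 1)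
    {x : EuclideanSpace ℝ (Fin d)} (hx : lpNorm p x ≤ 1) :
    ∑ i, |x i| ≤ (l0 x : ℝ) ^ (1 / q) := by
  have hsupp : ∑ i, |x i| = ∑ i with x i ≠ 0, |x i| := by
    rw [Finset.sum_filter]
    refine Finset.sum_congr rfl fun i _ => ?_
    by_cases h : x i = 0 <;> simp [h]
  rw [hsupp]
  unfold lpNorm at hx
  split_ifs at hpq hx with htop
  · have hle : ∀ i, |x i| ≤ 1 := fun i =>
      (le_ciSup (f := fun i => |x i|) (Set.finite_range _).bddAbove i).trans hx
    calc ∑ i with x i ≠ 0, |x i| ≤ ∑ i with x i ≠ 0, (1 : ℝ) :=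
          Finset.sum_le_sum fun i _ => hle i
      _ = (l0 x : ℝ) ^ (1 / q) := by simp [l0, hpq]
  · have hp1 : 1 < p.toReal := by
      rw [← ENNReal.toReal_one]
      exact (ENNReal.toReal_lt_toReal ENNReal.one_ne_top htop).2 hp
    have hconj : p.toReal.HolderConjugate q :=
      Real.holderConjugate_iff.2 ⟨hp1, by simpa only [one_div] using hpq⟩
    have hbound : (∑ i with x i ≠ 0, |x i| ^ p.toReal) ^ (1 / p.toReal) ≤ 1 := by
      refine le_trans (Real.rpow_le_rpow (by positivity) ?_ (by positivity)) hx
      exact Finset.sum_le_sum_of_subset_of_nonneg (Finset.filter_subset _ _)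
        fun i _ _ => by positivity
    calc ∑ i with x i ≠ 0, |x i| = ∑ i with x i ≠ 0, |x i| * 1 := by simp
      _ ≤ (∑ i with x i ≠ 0, |x i| ^ p.toReal) ^ (1 / p.toReal) *
          (∑ i with x i ≠ 0, (1 : ℝ) ^ q) ^ (1 / q) :=
        Real.inner_le_Lp_mul_Lq_of_nonneg _ hconj (fun i _ => abs_nonneg _)
          fun i _ => zero_le_one
      _ ≤ 1 * (∑ i with x i ≠ 0, (1 : ℝ) ^ q) ^ (1 / q) := by gcongr
      _ = (l0 x : ℝ) ^ (1 / q) := by simp [l0]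

theorem l0_single_one {d : ℕ} (i : Fin d) : l0 (EuclideanSpace.single i (1 : ℝ)) = 1 := by
  rw [l0, Finset.card_eq_one]
  refine ⟨i, ?_⟩
  ext j
  simp

theorem lpNorm_single_one_le {d : ℕ} {p : ℝ≥0∞} (hp : p ≠ 0) (i : Fin d) :
    lpNorm p (EuclideanSpace.single i (1 : ℝ)) ≤ 1 := by
  unfold lpNorm
  split_ifs with htop
  · have : Nonempty (Fin d) := ⟨i⟩
    refine ciSup_le fun j => ?_
    by_cases h : j = i <;> simp [h]
  · have hpos : p.toReal ≠ 0 := (ENNReal.toReal_pos hp htop).ne'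
    have hterm : ∀ j, |(EuclideanSpace.single i (1 : ℝ)) j| ^ p.toReal = if j = i then 1 else 0 := by
      intro j
      by_cases h : j = i <;> simp [h, hpos]
    simp only [hterm]
    simp

theorem le_mul_sum_abs_of_le_on_basis {d : ℕ} {N : EuclideanSpace ℝ (Fin d) → ℝ}
    (hadd : ∀ u v, N (u + v) ≤ N u + N v) (hsmul : ∀ (ρ : ℝ) u, N (ρ • u) = |ρ| * N u)
    {c : ℝ} (hc : ∀ i, N (EuclideanSpace.single i 1) ≤ c) (x : EuclideanSpace ℝ (Fin d)) :
    N x ≤ c * ∑ i, |x i| := by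
  have hzero : N 0 = 0 := by simpa using hsmul 0 0
  have hx : x = ∑ i, x i • EuclideanSpace.single i (1 : ℝ) := by
    ext j
    simp [Pi.single_apply]
  calc N x = N (∑ i, x i • EuclideanSpace.single i (1 : ℝ)) := by rw [← hx]
    _ ≤ ∑ i, N (x i • EuclideanSpace.single i (1 : ℝ)) :=
      Finset.le_sum_of_subadditive N hzero.le hadd _ _
    _ ≤ ∑ i, c * |x i| := by
      refine Finset.sum_le_sum fun i _ => ?_
      rw [hsmul, mul_comm]
      exact mul_le_mul_of_nonneg_right (hc i) (abs_nonneg _)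
    _ = c * ∑ i, |x i| := by rw [Finset.mul_sum]

theorem stmt15 (d : ℕ) (hd : 0 < d) (p : ℝ≥0∞) (hp : 1 < p) (q : ℝ) (hq : 1 ≤ q)
    (hpq : if p = ⊤ then q = 1 else 1 / p.toReal + 1 / q = 1)
    (φ : ℕ → ℝ≥0∞) (hφ0 : φ 0 = 0) (hφpos : ∀ l, 1 ≤ l → l ≤ d → 0 < φ l)
    (hφfin : ∃ l, 1 ≤ l ∧ l ≤ d ∧ φ l ≠ ⊤)
    (hφmono : ∀ l, 1 ≤ l → l + 1 ≤ d →
      φ l ^ q / (l : ℝ≥0∞) ≤ φ (l + 1) ^ q / ((l : ℝ≥0∞) + 1)) :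
    φ 1 ≠ ⊤
    ∧ (∀ x : EuclideanSpace ℝ (Fin d), lpNorm p x ≤ 1 →
        φ 1 * ENNReal.ofReal (∑ i, |x i|) ≤ φ (l0 x))
    ∧ (∀ N : EuclideanSpace ℝ (Fin d) → ℝ,
      (∀ u v, N (u + v) ≤ N u + N v) →
      (∀ (ρ : ℝ) u, N (ρ • u) = |ρ| * N u) →
      (∀ u, 0 ≤ N u) → (∀ u, N u = 0 ↔ u = 0) →
      (∀ x, lpNorm p x ≤ 1 → ENNReal.ofReal (N x) ≤ φ (l0 x)) →
      ∀ x, ENNReal.ofReal (N x) ≤ φ 1 * ENNReal.ofReal (∑ i, |x i|)) := by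
  have hq0 : 0 < q := by linarith
  have hlow {l : ℕ} (hl : l ≤ d) := mul_natCast_rpow_le_of_rpow_div_le hq0 hφmono hl
  have hfin : φ 1 ≠ ⊤ := by
    obtain ⟨l, hl1, hld, hlfin⟩ := hφfin
    intro htop
    have hle := hlow hld
    have hne : (l : ℝ≥0∞) ^ (1 / q) ≠ 0 := by
      simp [ENNReal.rpow_eq_zero_iff, hq0, Nat.one_le_iff_ne_zero.1 hl1]
    rw [htop, ENNReal.top_mul hne, top_le_iff] at hle
    exact hlfin hle
  refine ⟨hfin, fun x hx => ?_, fun N hadd hsmul _ _ hN x => ?_⟩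
  · have hl0 : l0 x ≤ d := (Finset.card_filter_le _ _).trans (by simp)
    refine le_trans (mul_le_mul_right ?_ _) (hlow hl0)
    calc ENNReal.ofReal (∑ i, |x i|) ≤ ENNReal.ofReal ((l0 x : ℝ) ^ (1 / q)) :=
          ENNReal.ofReal_le_ofReal (sum_abs_le_l0_rpow hp hpq hx)
      _ = (l0 x : ℝ≥0∞) ^ (1 / q) := by
        rw [← ENNReal.ofReal_rpow_of_nonneg (Nat.cast_nonneg _) (by positivity),
          ENNReal.ofReal_natCast]
  · have hbasis (i : Fin d) : N (EuclideanSpace.single i 1) ≤ (φ 1).toReal := by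
      have h := hN _ (lpNorm_single_one_le (zero_lt_one.trans hp).ne' i)
      rw [l0_single_one] at h
      exact (ENNReal.ofReal_le_iff_le_toReal hfin).1 h
    calc ENNReal.ofReal (N x) ≤ ENNReal.ofReal ((φ 1).toReal * ∑ i, |x i|) :=
          ENNReal.ofReal_le_ofReal (le_mul_sum_abs_of_le_on_basis hadd hsmul hbasis x)
      _ = φ 1 * ENNReal.ofReal (∑ i, |x i|) := by
        rw [ENNReal.ofReal_mul ENNReal.toReal_nonneg, ENNReal.ofReal_toReal hfin]
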